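/- Let γ > 1, let w₁, …, w_N ∈ ℝ⁴ be states all lying in the admissible set G, and let ω₁, …, ω_N be positive reals with Σᵢ ωᵢ = 1. Then the weighted cell average w̄ = Σᵢ ωᵢ wᵢ also lies in G; in particular the cell-averaged density and cell-averaged pressure p(w̄) are positive. -/

import Mathlib

/-- Pressure of a 2D Euler state `w = (ρ, m, n, E)`. -/
noncomputable def eulerPressure (γ : ℝ) (w : Fin 4 → ℝ) : ℝ :=
  (γ - 1) * (w 3 - ((w 1) ^ 2 + (w 2) ^ 2) / (2 * w 0))

/-- The set of admissible states of the 2D compressible Euler equations. -/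
def admissibleSet (γ : ℝ) : Set (Fin 4 → ℝ) :=
  {w | 0 < w 0 ∧ 0 < eulerPressure γ w}

/-- Jensen's inequality for the pressure, which is superadditive and positively homogeneous on
states of positive density. -/
theorem sum_mul_eulerPressure_le {ι : Type*} (s : Finset ι) {γ : ℝ} (hγ : 1 ≤ γ)
    (w : ι → (Fin 4 → ℝ)) (ω : ι → ℝ) (hω : ∀ i ∈ s, 0 < ω i) (hρ : ∀ i ∈ s, 0 < w i 0) :
    ∑ i ∈ s, ω i * eulerPressure γ (w i) ≤ eulerPressure γ (∑ i ∈ s, ω i • w i) := by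
  have kinetic (k : Fin 4) : (∑ i ∈ s, ω i * w i k) ^ 2 / (∑ i ∈ s, ω i * w i 0) ≤
      ∑ i ∈ s, ω i * (w i k ^ 2 / w i 0) := by
    refine (Finset.sq_sum_div_le_sum_sq_div s _
      fun i hi => mul_pos (hω i hi) (hρ i hi)).trans_eq (Finset.sum_congr rfl fun i hi => ?_)
    have := (hω i hi).ne'
    have := (hρ i hi).ne'
    field_simp
  have split (v : Fin 4 → ℝ) : eulerPressure γ v =
      (γ - 1) * (v 3 - (v 1 ^ 2 / v 0 + v 2 ^ 2 / v 0) / 2) := by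
    rw [eulerPressure, ← add_div, div_div, mul_comm (v 0)]
  have average : ∑ i ∈ s, ω i * eulerPressure γ (w i) =
      (γ - 1) * (∑ i ∈ s, ω i * w i 3 - (∑ i ∈ s, ω i * (w i 1 ^ 2 / w i 0) +
        ∑ i ∈ s, ω i * (w i 2 ^ 2 / w i 0)) / 2) := by
    rw [← Finset.sum_add_distrib, Finset.sum_div, ← Finset.sum_sub_distrib, Finset.mul_sum]
    refine Finset.sum_congr rfl fun i _ => ?_
    rw [split]
    ring
  rw [average, split]
  simp only [Finset.sum_apply, Pi.smul_apply, smul_eq_mul]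
  refine mul_le_mul_of_nonneg_left ?_ (sub_nonneg.2 hγ)
  linarith [kinetic 1, kinetic 2]

/-- A positively weighted average (with weights summing to one) of admissible states
is admissible; in particular, the cell-averaged density and pressure are positive. -/
theorem cellAverage_mem_admissibleSet (γ : ℝ) (hγ : 1 < γ) {N : ℕ}
    (w : Fin N → (Fin 4 → ℝ)) (ω : Fin N → ℝ)
    (hω : ∀ i, 0 < ω i) (hsum : ∑ i, ω i = 1)
    (hw : ∀ i, w i ∈ admissibleSet γ) :
    (∑ i, ω i • w i) ∈ admissibleSet γ ∧
      0 < (∑ i, ω i • w i) 0 ∧ 0 < eulerPressure γ (∑ i, ω i • w i) := by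
  have hne : (Finset.univ : Finset (Fin N)).Nonempty :=
    Finset.nonempty_of_sum_ne_zero (hsum ▸ one_ne_zero)
  have hdensity : 0 < (∑ i, ω i • w i) 0 := by
    simp only [Finset.sum_apply, Pi.smul_apply, smul_eq_mul]
    exact Finset.sum_pos (fun i _ => mul_pos (hω i) (hw i).1) hne
  have hpressure : 0 < eulerPressure γ (∑ i, ω i • w i) :=
    (Finset.sum_pos (fun i _ => mul_pos (hω i) (hw i).2) hne).trans_le
      (sum_mul_eulerPressure_le _ hγ.le w ω (fun i _ => hω i) fun i _ => (hw i).1)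
  exact ⟨⟨hdensity, hpressure⟩, hdensity, hpressure⟩
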